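/- Define B_θ(s) = (1/(2π))·log((1 + sin θ)/(1 - sin θ)) + (1 - θ/π)·(1/cos θ + s). Then for every θ ∈ [1.148, π/2) and every real s with s ≥ π·(tan θ + π - 2θ + 3)/(4(π - θ)), we have B_θ(s) > 3.5509015. -/

import Mathlib

open Real

/-- The cost of deployment angle `θ` when the partial-inspection cost equals its lower bound. -/
noncomputable def minimalCost (θ : ℝ) : ℝ :=
  (1 / (2 * π)) * (log (1 + sin θ) - log (1 - sin θ)) + (1 - θ / π) * (1 / cos θ)
    + (tan θ + π - 2 * θ + 3) / 4

theorem sin_lt_one_of_cos_pos {θ : ℝ} (h : 0 < cos θ) : sin θ < 1 := by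
  nlinarith [sin_sq_add_cos_sq θ, sin_le_one θ]

theorem hasDerivAt_minimalCost {θ : ℝ} (hs : 0 < sin θ) (hc : 0 < cos θ) :
    HasDerivAt minimalCost
      ((1 - θ / π) * (sin θ / cos θ ^ 2) + (1 / cos θ ^ 2 - 2) / 4) θ := by
  have hs1 : 0 < 1 - sin θ := sub_pos.2 (sin_lt_one_of_cos_pos hc)
  have hlog_add := ((hasDerivAt_sin θ).const_add 1).log (by positivity)
  have hlog_sub := ((hasDerivAt_sin θ).const_sub 1).log hs1.ne'
  have hlog := (hlog_add.sub hlog_sub).const_mul (1 / (2 * π))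
  have hfactor := ((hasDerivAt_id θ).div_const π).const_sub 1
  have hsec := (hasDerivAt_const θ (1 : ℝ)).div (hasDerivAt_cos θ) hc.ne'
  have htan := ((((hasDerivAt_tan hc.ne').add_const π).sub
    ((hasDerivAt_id θ).const_mul 2)).add_const 3).div_const 4
  have h := (hlog.add (hfactor.mul hsec)).add htan
  have hsec_eq : cos θ / (1 + sin θ) - -cos θ / (1 - sin θ) = 2 / cos θ := by
    field_simp
    linear_combination 2 * sin_sq_add_cos_sq θ
  refine h.congr_deriv ?_
  rw [hsec_eq]
  simp only [id, Pi.div_apply]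
  field_simp
  ring

theorem strictMonoOn_minimalCost : StrictMonoOn minimalCost (Set.Ico (1.148 : ℝ) (π / 2)) := by
  have hd : ∀ θ ∈ Set.Ico (1.148 : ℝ) (π / 2), 0 < sin θ ∧ 0 < cos θ := fun θ hθ =>
    ⟨sin_pos_of_pos_of_lt_pi (by linarith [hθ.1]) (by linarith [hθ.2, pi_pos]),
      cos_pos_of_mem_Ioo ⟨by linarith [hθ.1, pi_pos], hθ.2⟩⟩
  refine strictMonoOn_of_deriv_pos (convex_Ico _ _) (fun θ hθ =>
    (hasDerivAt_minimalCost (hd θ hθ).1 (hd θ hθ).2).continuousAt.continuousWithinAt) ?_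
  intro θ hθ
  rw [interior_Ico] at hθ
  obtain ⟨hs, hc⟩ := hd θ ⟨hθ.1.le, hθ.2⟩
  rw [(hasDerivAt_minimalCost hs hc).deriv]
  have hfactor : 0 < 1 - θ / π := by
    rw [sub_pos, div_lt_one pi_pos]
    linarith [hθ.2, pi_pos]
  have hcos_sq : cos θ ^ 2 < 1 / 2 := by
    have : cos (2 * θ) < 0 := cos_neg_of_pi_div_two_lt_of_lt
      (by linarith [hθ.1, pi_lt_d2]) (by linarith [hθ.2, pi_pos])
    rw [cos_two_mul] at this
    linarith
  have hsec_sq : 2 < 1 / cos θ ^ 2 := by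
    rw [lt_div_iff₀ (by positivity)]
    linarith
  have : 0 < (1 - θ / π) * (sin θ / cos θ ^ 2) := by positivity
  linarith

theorem cos_two_mul_le {x q r : ℝ} (h0 : 0 ≤ cos x) (h : cos x ≤ q) (hr : 2 * q ^ 2 - 1 ≤ r) :
    cos (2 * x) ≤ r := by
  rw [cos_two_mul]
  nlinarith

theorem cos_1148_lt : cos 1.148 < 0.4104 := by
  have hpos : ∀ x : ℝ, 0 ≤ x → x ≤ 1 → 0 ≤ cos x := fun x h0 h1 =>
    cos_nonneg_of_mem_Icc ⟨by linarith [pi_pos], by linarith [pi_gt_three]⟩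
  have h := (abs_le.1 (cos_bound (x := 1.148 / 32) (by norm_num [abs_of_pos]))).2
  have h32 : cos (1.148 / 32) ≤ 0.99935658 := by
    norm_num [abs_of_pos] at h ⊢
    linarith
  have h16 := cos_two_mul_le (r := 0.997427149) (hpos _ (by norm_num) (by norm_num)) h32 (by norm_num)
  have h8 := cos_two_mul_le (r := 0.989721837) (hpos _ (by norm_num) (by norm_num)) h16 (by norm_num)
  have h4 := cos_two_mul_le (r := 0.95909863) (hpos _ (by norm_num) (by norm_num)) h8 (by norm_num)
  have h2 := cos_two_mul_le (r := 0.83974037) (hpos _ (by norm_num) (by norm_num)) h4 (by norm_num)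
  have h1 := cos_two_mul_le (r := 0.41033) (hpos _ (by norm_num) (by norm_num)) h2 (by norm_num)
  norm_num at h1 ⊢
  linarith

theorem lt_minimalCost_1148 : 3.5509015 < minimalCost 1.148 := by
  have hc0 : 0 < cos 1.148 := cos_pos_of_mem_Ioo
    ⟨by linarith [pi_pos], by linarith [pi_gt_three]⟩
  have hs0 : 0 < sin 1.148 := sin_pos_of_pos_of_lt_pi (by norm_num) (by linarith [pi_gt_three])
  have hc := cos_1148_lt
  have hs : 0.9119 < sin 1.148 := by
    nlinarith [sin_sq_add_cos_sq 1.148]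
  have hs1 : 0 < 1 - sin 1.148 := sub_pos.2 (sin_lt_one_of_cos_pos hc0)
  have hratio : 21.7 ≤ (1 + sin 1.148) / (1 - sin 1.148) := by
    rw [le_div_iff₀ hs1]
    linarith
  have hlog_two : 133 * log 2 ≤ 30 * log 21.7 := by
    have := log_le_log (by norm_num) (show (2 : ℝ) ^ 133 ≤ 21.7 ^ 30 by norm_num)
    rw [log_pow, log_pow] at this
    exact_mod_cast this
  have hlog : 3.0729 < log (1 + sin 1.148) - log (1 - sin 1.148) := by
    rw [← log_div (by positivity) hs1.ne']
    linarith [log_le_log (by norm_num) hratio, log_two_gt_d9]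
  have hsec : 2.4366 < 1 / cos 1.148 := by
    rw [lt_div_iff₀ hc0]
    linarith
  have htan : 2.2219 < tan 1.148 := by
    rw [tan_eq_sin_div_cos, lt_div_iff₀ hc0]
    linarith
  have hpi := pi_gt_d6
  have hpi' := pi_lt_d6
  have hinv : 0.159 < 1 / (2 * π) := by
    rw [lt_div_iff₀ (by positivity)]
    linarith
  have hfactor : 0.6345 < 1 - 1.148 / π := by
    have : 1.148 / π < 0.3655 := by
      rw [div_lt_iff₀ pi_pos]
      linarith
    linarith
  have hlog_term : 0.159 * 3.0729 < 1 / (2 * π) * (log (1 + sin 1.148) - log (1 - sin 1.148)) :=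
    mul_lt_mul'' hinv hlog (by norm_num) (by norm_num)
  have hsec_term : 0.6345 * 2.4366 < (1 - 1.148 / π) * (1 / cos 1.148) :=
    mul_lt_mul'' hfactor hsec (by norm_num) (by norm_num)
  unfold minimalCost
  linarith

/-- For deployment angles θ ∈ [1.148, π/2) and any partial-inspection cost s at least the
proved lower bound, the total cost B_θ(s) exceeds the known upper bound 3.5509015. -/
theorem stmt_13 (B : ℝ → ℝ → ℝ)
    (hB : ∀ θ s : ℝ, B θ s = (1 / (2 * π)) * Real.log ((1 + Real.sin θ) / (1 - Real.sin θ))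
        + (1 - θ / π) * (1 / Real.cos θ + s)) :
    ∀ θ ∈ Set.Ico (1.148 : ℝ) (π / 2), ∀ s : ℝ,
      π * (Real.tan θ + π - 2 * θ + 3) / (4 * (π - θ)) ≤ s →
      (3.5509015 : ℝ) < B θ s := by
  intro θ hθ s hs
  have hπθ : 0 < π - θ := by linarith [hθ.2, pi_pos]
  have hc : 0 < cos θ := cos_pos_of_mem_Ioo ⟨by linarith [hθ.1, pi_pos], hθ.2⟩
  have hsin : 0 < sin θ :=
    sin_pos_of_pos_of_lt_pi (by linarith [hθ.1]) (by linarith)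
  have hs1 : 0 < 1 - sin θ := sub_pos.2 (sin_lt_one_of_cos_pos hc)
  have hmono : minimalCost 1.148 ≤ minimalCost θ :=
    strictMonoOn_minimalCost.monotoneOn ⟨le_rfl, hθ.1.trans_lt hθ.2⟩ hθ hθ.1
  have hfactor : 1 - θ / π = (π - θ) / π := by field_simp
  have hterm : (tan θ + π - 2 * θ + 3) / 4 ≤ (1 - θ / π) * s := by
    calc (tan θ + π - 2 * θ + 3) / 4
        = (1 - θ / π) * (π * (tan θ + π - 2 * θ + 3) / (4 * (π - θ))) := by
          rw [hfactor]
          field_simp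
      _ ≤ (1 - θ / π) * s := by
          rw [hfactor]
          gcongr
  have hbound := lt_minimalCost_1148
  rw [hB, log_div (by positivity) hs1.ne', mul_add]
  unfold minimalCost at hmono hbound
  linarith
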